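/- Let f : B₁ → B₂ be a homomorphism of skew braces with kernel J = Ker f. Then, viewed as a map of the associated solutions (B₁, r_{B₁}) → (B₂, r_{B₂}), f is an i-homomorphism with i-kernel J; concretely, the equivalence classes of the kernel relation of f are exactly the cosets b·J for b ∈ B₁, and r_{B₁}(b·J × J) = J × b·J and r_{B₁}(J × b·J) = b·J × J for every b ∈ B₁. -/

import Mathlib

/-!
Common definitions: skew braces, set-theoretic solutions of the Yang–Baxter
equation, structure skew braces, ideals, i-homomorphisms, solubility.
-/

universe u v

/-- A skew (left) brace: two group structures `(B,+)` and `(B,·)` sharing the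
same identity `0`, with `a·(b+c) = a·b − a + a·c`. -/
structure SkewBrace (B : Type u) where
  add : B → B → B
  zero : B
  neg : B → B
  mul : B → B → B
  inv : B → B
  add_assoc : ∀ a b c, add (add a b) c = add a (add b c)
  zero_add : ∀ a, add zero a = a
  add_zero : ∀ a, add a zero = a
  neg_add : ∀ a, add (neg a) a = zero
  add_neg : ∀ a, add a (neg a) = zero
  mul_assoc : ∀ a b c, mul (mul a b) c = mul a (mul b c)
  zero_mul : ∀ a, mul zero a = a
  mul_zero : ∀ a, mul a zero = a
  inv_mul : ∀ a, mul (inv a) a = zero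
  mul_inv : ∀ a, mul a (inv a) = zero
  compat : ∀ a b c, mul a (add b c) = add (add (mul a b) (neg a)) (mul a c)

namespace SkewBrace

variable {B : Type u} (S : SkewBrace B)

/-- `λ_a(b) = −a + a·b`. -/
def lam (a b : B) : B := S.add (S.neg a) (S.mul a b)

/-- `ρ_b(a) = λ_a(b)⁻¹ · a · b`. -/
def rho (b a : B) : B := S.mul (S.mul (S.inv (S.lam a b)) a) b

/-- The solution of the YBE associated with a skew brace:
`r_B(a,b) = (λ_a(b), ρ_b(a))`. -/
def rB : B × B → B × B := fun p => (S.lam p.1 p.2, S.rho p.2 p.1)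

end SkewBrace

/-- Homomorphism of skew braces: preserves both operations. -/
def IsHom {B : Type u} {C : Type v} (S : SkewBrace B) (T : SkewBrace C) (f : B → C) : Prop :=
  (∀ a b, f (S.add a b) = T.add (f a) (f b)) ∧ (∀ a b, f (S.mul a b) = T.mul (f a) (f b))

/-- The kernel of a skew brace homomorphism: preimage of `0`. -/
def brKer {B : Type u} {C : Type v} (T : SkewBrace C) (f : B → C) : Set B :=
  {a | f a = T.zero}

/-- An ideal of a skew brace: a sub-skew brace, normal in both `(B,+)` and `(B,·)`,
and `λ_b`-invariant for all `b`. -/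
def IsIdeal {B : Type u} (S : SkewBrace B) (I : Set B) : Prop :=
  S.zero ∈ I ∧
  (∀ a ∈ I, ∀ b ∈ I, S.add a b ∈ I) ∧ (∀ a ∈ I, S.neg a ∈ I) ∧
  (∀ a ∈ I, ∀ b ∈ I, S.mul a b ∈ I) ∧ (∀ a ∈ I, S.inv a ∈ I) ∧
  (∀ b : B, ∀ a ∈ I, S.add (S.add b a) (S.neg b) ∈ I) ∧
  (∀ b : B, ∀ a ∈ I, S.mul (S.mul b a) (S.inv b) ∈ I) ∧
  (∀ b : B, S.lam b '' I = I)

/-- A skew brace is simple if it is non-trivial and its only ideals are `{0}` and `B`. -/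
def IsSimpleBrace {B : Type u} (S : SkewBrace B) : Prop :=
  (∃ a : B, a ≠ S.zero) ∧
  ∀ I : Set B, IsIdeal S I → I = {S.zero} ∨ I = Set.univ

/-- The socle of a skew brace: elements `a` with `λ_a = id` commuting additively
with everything. -/
def Soc {B : Type u} (S : SkewBrace B) : Set B :=
  {a | (∀ b, S.lam a b = b) ∧ (∀ b, S.add a b = S.add b a)}

/-- `r × id` on triples. -/
def rOne {X : Type u} (r : X × X → X × X) : X × X × X → X × X × X :=
  fun p => ((r (p.1, p.2.1)).1, (r (p.1, p.2.1)).2, p.2.2)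

/-- `id × r` on triples. -/
def rTwo {X : Type u} (r : X × X → X × X) : X × X × X → X × X × X :=
  fun p => (p.1, r p.2)

/-- `(X,r)` is a set-theoretic solution of the Yang–Baxter equation. -/
def IsSolution {X : Type u} (r : X × X → X × X) : Prop :=
  Function.Bijective r ∧
  rOne r ∘ rTwo r ∘ rOne r = rTwo r ∘ rOne r ∘ rTwo r

/-- `λ_x(y)` for a solution, i.e. the first component of `r(x,y)`. -/
def lamMap {X : Type u} (r : X × X → X × X) (x : X) : X → X := fun y => (r (x, y)).1

/-- `ρ_y(x)` for a solution, i.e. the second component of `r(x,y)`. -/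
def rhoMap {X : Type u} (r : X × X → X × X) (y : X) : X → X := fun x => (r (x, y)).2

/-- Non-degeneracy: all `λ_x` and `ρ_y` are bijective. -/
def Nondeg {X : Type u} (r : X × X → X × X) : Prop :=
  (∀ x, Function.Bijective (lamMap r x)) ∧ (∀ y, Function.Bijective (rhoMap r y))

/-- Homomorphism of solutions: `(f×f)∘r = s∘(f×f)`. -/
def IsSolHom {X : Type u} {Y : Type v} (r : X × X → X × X) (s : Y × Y → Y × Y)
    (f : X → Y) : Prop :=
  Prod.map f f ∘ r = s ∘ Prod.map f f

/-- The structure skew brace `(G_X, ι)` of a solution `(X,r)`: the image of `ι`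
generates `(G_X,·)`, `ι` intertwines `r` with `r_{G_X}`, and the pair has the
universal property for maps into skew braces. -/
structure StructureBrace {X : Type u} (r : X × X → X × X) where
  G : Type u
  S : SkewBrace G
  ι : X → G
  gen : ∀ H : Set G, S.zero ∈ H → (∀ a ∈ H, ∀ b ∈ H, S.mul a b ∈ H) →
      (∀ a ∈ H, S.inv a ∈ H) → Set.range ι ⊆ H → H = Set.univ
  compat : Prod.map ι ι ∘ r = S.rB ∘ Prod.map ι ι
  univ : ∀ {C : Type u} (T : SkewBrace C) (g : X → C),
      Prod.map g g ∘ r = T.rB ∘ Prod.map g g →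
      ∃! h : G → C, IsHom S T h ∧ h ∘ ι = g

/-- The multiplicative subgroup (as a set) generated by a subset. -/
def mulClosure {B : Type u} (S : SkewBrace B) (A : Set B) : Set B :=
  ⋂₀ {H : Set B | S.zero ∈ H ∧ (∀ a ∈ H, ∀ b ∈ H, S.mul a b ∈ H) ∧
      (∀ a ∈ H, S.inv a ∈ H) ∧ A ⊆ H}

/-- The additive subgroup (as a set) generated by a subset. -/
def addClosure {B : Type u} (S : SkewBrace B) (A : Set B) : Set B :=
  ⋂₀ {H : Set B | S.zero ∈ H ∧ (∀ a ∈ H, ∀ b ∈ H, S.add a b ∈ H) ∧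
      (∀ a ∈ H, S.neg a ∈ H) ∧ A ⊆ H}

/-- The ideal generated by a subset: intersection of all ideals containing it. -/
def idealClosure {B : Type u} (S : SkewBrace B) (A : Set B) : Set B :=
  ⋂₀ {I : Set B | IsIdeal S I ∧ A ⊆ I}

/-- Product of two subsets in the multiplicative group. -/
def setMul {B : Type u} (S : SkewBrace B) (A₁ A₂ : Set B) : Set B :=
  {c | ∃ a ∈ A₁, ∃ b ∈ A₂, c = S.mul a b}

/-- Sum of two subsets in the additive group. -/
def setAdd {B : Type u} (S : SkewBrace B) (A₁ A₂ : Set B) : Set B :=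
  {c | ∃ a ∈ A₁, ∃ b ∈ A₂, c = S.add a b}

/-- The multiplicative left coset `a·I`. -/
def lCoset {B : Type u} (S : SkewBrace B) (a : B) (I : Set B) : Set B :=
  (fun w => S.mul a w) '' I

/-- Equivalence class of the kernel relation of a map. -/
def kerClass {X : Type u} {Y : Type v} (f : X → Y) (x : X) : Set X := {z | f z = f x}

/-- `X₀` is an i-kernel of the homomorphism of solutions `f : (X,r) → (Y,s)`:
`f` is a homomorphism of solutions, `X₀` is an equivalence class of `ker f`, and
for every class `Z` of `ker f`, `r(X₀ × Z) = Z × X₀` and `r(Z × X₀) = X₀ × Z`.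
A homomorphism admitting such a class is an i-homomorphism. -/
def IsIKernel {X : Type u} {Y : Type v} (r : X × X → X × X) (s : Y × Y → Y × Y)
    (f : X → Y) (X₀ : Set X) : Prop :=
  IsSolHom r s f ∧ (∃ x : X, X₀ = kerClass f x) ∧
  ∀ z : X, r '' (X₀ ×ˢ kerClass f z) = (kerClass f z) ×ˢ X₀ ∧
           r '' ((kerClass f z) ×ˢ X₀) = X₀ ×ˢ (kerClass f z)

/-- A strong left ideal: a `λ`-invariant subgroup of `(B,+)` which is normal
in `(B,+)`. -/
def IsStrongLeftIdeal {B : Type u} (S : SkewBrace B) (I : Set B) : Prop :=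
  S.zero ∈ I ∧ (∀ a ∈ I, ∀ b ∈ I, S.add a b ∈ I) ∧ (∀ a ∈ I, S.neg a ∈ I) ∧
  (∀ b : B, S.lam b '' I = I) ∧
  (∀ b : B, ∀ a ∈ I, S.add (S.add b a) (S.neg b) ∈ I)

/-- An abelian ideal: an ideal on which the two operations coincide and are
commutative (so it is an abelian/trivial skew brace). -/
def IsAbelianIdeal {C : Type u} (T : SkewBrace C) (J : Set C) : Prop :=
  IsIdeal T J ∧ ∀ a ∈ J, ∀ b ∈ J, T.mul a b = T.add a b ∧ T.add a b = T.add b a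

/-- Solubility of a skew brace: epimorphisms `f_k : B → B_k`, `0 ≤ k ≤ t`, with
`Ker f_t = 0 ⊆ … ⊆ Ker f_0 = B` and `f_k(Ker f_{k−1})` an abelian ideal of `B_k`. -/
def IsSoluble {B : Type u} (S : SkewBrace B) : Prop :=
  ∃ (t : ℕ) (C : Fin (t + 1) → Type u) (T : ∀ k, SkewBrace (C k)) (f : ∀ k, B → C k),
    (∀ k, IsHom S (T k) (f k) ∧ Function.Surjective (f k)) ∧
    brKer (T (Fin.last t)) (f (Fin.last t)) = {S.zero} ∧
    brKer (T 0) (f 0) = Set.univ ∧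
    (∀ k : Fin t, brKer (T k.succ) (f k.succ) ⊆ brKer (T k.castSucc) (f k.castSucc)) ∧
    (∀ k : Fin t, IsAbelianIdeal (T k.succ) (f k.succ '' brKer (T k.castSucc) (f k.castSucc)))

/-- Solubility of a solution `(X,r)` (with structure skew brace `(G_X, ι)`):
there are skew braces `B_0,…,B_t`, i-epimorphisms `f_k : (X,r) → (B_k, r_{B_k})`
with i-kernels `X_k` for `0 ≤ k ≤ t−1`, and an epimorphism `f_t`, such that
`ker f_k ⊆ ker f_{k−1}`, `ker f_0` is total, `ker f_t ⊆ ker ι`, and each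
`f_k(X_{k−1})` lies in an abelian ideal `J` of `B_k` with `f_k(x)·J = f_k(y)·J`
whenever `x (ker f_{k−1}) y`. -/
def IsSolubleSolution {X : Type u} (r : X × X → X × X) (GX : StructureBrace r) : Prop :=
  ∃ (t : ℕ) (C : Fin (t + 1) → Type u) (T : ∀ k, SkewBrace (C k))
    (f : ∀ k : Fin (t + 1), X → C k) (Xk : Fin t → Set X),
    (∀ k : Fin (t + 1), IsSolHom r (T k).rB (f k) ∧ Function.Surjective (f k)) ∧
    (∀ k : Fin t, IsIKernel r (T k.castSucc).rB (f k.castSucc) (Xk k)) ∧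
    (∀ x y : X, f 0 x = f 0 y) ∧
    (∀ k : Fin t, ∀ x y : X, f k.succ x = f k.succ y → f k.castSucc x = f k.castSucc y) ∧
    (∀ x y : X, f (Fin.last t) x = f (Fin.last t) y → GX.ι x = GX.ι y) ∧
    (∀ k : Fin t, ∃ J : Set (C k.succ), IsAbelianIdeal (T k.succ) J ∧
      f k.succ '' (Xk k) ⊆ J ∧
      ∀ x y : X, f k.castSucc x = f k.castSucc y →
        lCoset (T k.succ) (f k.succ x) J = lCoset (T k.succ) (f k.succ y) J)

/-- Decomposability of a solution: `X = Y ∪ Z` with `Y, Z` proper and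
`r(Y×Y) = Y×Y`, `r(Z×Z) = Z×Z`. -/
def Decomposable {X : Type u} (r : X × X → X × X) : Prop :=
  ∃ Y Z : Set X, Y ≠ Set.univ ∧ Z ≠ Set.univ ∧ Y ∪ Z = Set.univ ∧
    r '' (Y ×ˢ Y) = Y ×ˢ Y ∧ r '' (Z ×ˢ Z) = Z ×ˢ Z

namespace SkewBrace

variable {B : Type u} (S : SkewBrace B)

theorem neg_add_cancel_left (a b : B) : S.add (S.neg a) (S.add a b) = b := by
  rw [← S.add_assoc, S.neg_add, S.zero_add]

theorem add_neg_cancel_right (a b : B) : S.add (S.add a (S.neg b)) b = a := by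
  rw [S.add_assoc, S.neg_add, S.add_zero]

theorem inv_mul_cancel_left (a b : B) : S.mul (S.inv a) (S.mul a b) = b := by
  rw [← S.mul_assoc, S.inv_mul, S.zero_mul]

theorem mul_inv_cancel_left (a b : B) : S.mul a (S.mul (S.inv a) b) = b := by
  rw [← S.mul_assoc, S.mul_inv, S.zero_mul]

theorem eq_neg_of_add_eq_zero {a b : B} (h : S.add a b = S.zero) : b = S.neg a := by
  rw [← S.neg_add_cancel_left a b, h, S.add_zero]

theorem eq_inv_of_mul_eq_zero {a b : B} (h : S.mul a b = S.zero) : b = S.inv a := by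
  rw [← S.inv_mul_cancel_left a b, h, S.mul_zero]

theorem neg_zero : S.neg S.zero = S.zero :=
  (S.eq_neg_of_add_eq_zero (S.add_zero _)).symm

theorem inv_zero : S.inv S.zero = S.zero :=
  (S.eq_inv_of_mul_eq_zero (S.mul_zero _)).symm

theorem lam_zero_left (b : B) : S.lam S.zero b = b := by
  rw [lam, S.neg_zero, S.zero_mul, S.zero_add]

theorem lam_zero_right (a : B) : S.lam a S.zero = S.zero := by
  rw [lam, S.mul_zero, S.neg_add]

theorem rho_zero_left (a : B) : S.rho S.zero a = a := by
  rw [rho, S.lam_zero_right, S.inv_zero, S.zero_mul, S.mul_zero]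

theorem rho_zero_right (b : B) : S.rho b S.zero = S.zero := by
  rw [rho, S.lam_zero_left, S.mul_zero, S.inv_mul]

/-- The inverse of `r_B`: `(u, v) ↦ (a, a⁻¹·u·v)` with `a = u·v − u`. -/
def rBInv (p : B × B) : B × B :=
  (S.add (S.mul p.1 p.2) (S.neg p.1),
    S.mul (S.inv (S.add (S.mul p.1 p.2) (S.neg p.1))) (S.mul p.1 p.2))

theorem rB_rBInv (p : B × B) : S.rB (S.rBInv p) = p := by
  obtain ⟨x, y⟩ := p
  have hlam : S.lam (S.rBInv (x, y)).1 (S.rBInv (x, y)).2 = x := by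
    simp only [lam, rBInv, S.mul_inv_cancel_left]
    nth_rewrite 2 [← S.add_neg_cancel_right (S.mul x y) x]
    rw [S.neg_add_cancel_left]
  refine Prod.ext hlam ?_
  simp only [rB, rho, hlam]
  simp only [rBInv, S.mul_assoc, S.mul_inv_cancel_left, S.inv_mul_cancel_left]

end SkewBrace

namespace IsHom

variable {B : Type u} {C : Type v} {S : SkewBrace B} {T : SkewBrace C} {f : B → C}

theorem map_zero (hf : IsHom S T f) : f S.zero = T.zero := by
  rw [← T.neg_add_cancel_left (f S.zero) (f S.zero), ← hf.1, S.add_zero, T.neg_add]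

theorem map_neg (hf : IsHom S T f) (a : B) : f (S.neg a) = T.neg (f a) :=
  T.eq_neg_of_add_eq_zero (by rw [← hf.1, S.add_neg, hf.map_zero])

theorem map_inv (hf : IsHom S T f) (a : B) : f (S.inv a) = T.inv (f a) :=
  T.eq_inv_of_mul_eq_zero (by rw [← hf.2, S.mul_inv, hf.map_zero])

theorem map_lam (hf : IsHom S T f) (a b : B) : f (S.lam a b) = T.lam (f a) (f b) := by
  rw [SkewBrace.lam, hf.1, hf.2, hf.map_neg, SkewBrace.lam]

theorem map_rho (hf : IsHom S T f) (a b : B) : f (S.rho b a) = T.rho (f b) (f a) := by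
  rw [SkewBrace.rho, hf.2, hf.2, hf.map_inv, hf.map_lam, SkewBrace.rho]

theorem isSolHom (hf : IsHom S T f) : IsSolHom S.rB T.rB f :=
  funext fun p => Prod.ext (hf.map_lam p.1 p.2) (hf.map_rho p.1 p.2)

theorem brKer_eq_kerClass_zero (hf : IsHom S T f) : brKer T f = kerClass f S.zero := by
  rw [brKer, kerClass, hf.map_zero]

theorem kerClass_eq_lCoset (hf : IsHom S T f) (b : B) :
    kerClass f b = lCoset S b (brKer T f) := by
  ext z
  constructor
  · intro (hz : f z = f b)
    refine ⟨S.mul (S.inv b) z, ?_, S.mul_inv_cancel_left b z⟩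
    change f _ = T.zero
    rw [hf.2, hf.map_inv, hz, T.inv_mul]
  · rintro ⟨w, hw : f w = T.zero, rfl⟩
    change f (S.mul b w) = f b
    rw [hf.2, hw, T.mul_zero]

theorem rB_image_brKer_prod_kerClass (hf : IsHom S T f) (z : B) :
    S.rB '' (brKer T f ×ˢ kerClass f z) = kerClass f z ×ˢ brKer T f := by
  apply Set.Subset.antisymm
  · rintro _ ⟨⟨a, b⟩, ⟨ha : f a = T.zero, hb : f b = f z⟩, rfl⟩
    refine ⟨?_, ?_⟩
    · change f (S.lam a b) = f z
      rw [hf.map_lam, ha, T.lam_zero_left, hb]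
    · change f (S.rho b a) = T.zero
      rw [hf.map_rho, ha, T.rho_zero_right]
  · rintro ⟨x, y⟩ ⟨hx : f x = f z, hy : f y = T.zero⟩
    refine ⟨S.rBInv (x, y), ⟨?_, ?_⟩, S.rB_rBInv _⟩
    · change f (S.add _ _) = T.zero
      rw [hf.1, hf.2, hf.map_neg, hy, T.mul_zero, T.add_neg]
    · change f (S.mul _ (S.mul x y)) = f z
      rw [hf.2, hf.map_inv, hf.1, hf.2, hf.map_neg, hy, T.mul_zero, T.add_neg,
        T.inv_zero, T.zero_mul, hx]

theorem rB_image_kerClass_prod_brKer (hf : IsHom S T f) (z : B) :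
    S.rB '' (kerClass f z ×ˢ brKer T f) = brKer T f ×ˢ kerClass f z := by
  apply Set.Subset.antisymm
  · rintro _ ⟨⟨a, b⟩, ⟨ha : f a = f z, hb : f b = T.zero⟩, rfl⟩
    refine ⟨?_, ?_⟩
    · change f (S.lam a b) = T.zero
      rw [hf.map_lam, hb, T.lam_zero_right]
    · change f (S.rho b a) = f z
      rw [hf.map_rho, hb, T.rho_zero_left, ha]
  · rintro ⟨x, y⟩ ⟨hx : f x = T.zero, hy : f y = f z⟩
    refine ⟨S.rBInv (x, y), ⟨?_, ?_⟩, S.rB_rBInv _⟩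
    · change f (S.add _ _) = f z
      rw [hf.1, hf.2, hf.map_neg, hx, T.zero_mul, T.neg_zero, T.add_zero, hy]
    · change f (S.mul _ (S.mul x y)) = T.zero
      rw [hf.2, hf.map_inv, hf.1, hf.2, hf.map_neg, hx, T.zero_mul, T.neg_zero,
        T.add_zero, T.inv_mul]

end IsHom

/-- A homomorphism of skew braces `f : B₁ → B₂` with kernel `J` is,
as a map of the associated solutions, an i-homomorphism with i-kernel `J`: the
classes of `ker f` are the cosets `b·J`, and `r_{B₁}(b·J × J) = J × b·J` and
`r_{B₁}(J × b·J) = b·J × J`. -/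
theorem stmt_9 {B₁ : Type u} {B₂ : Type v} (S : SkewBrace B₁) (T : SkewBrace B₂)
    (f : B₁ → B₂) (hf : IsHom S T f) :
    IsIKernel S.rB T.rB f (brKer T f) ∧
    (∀ b : B₁, kerClass f b = lCoset S b (brKer T f)) ∧
    (∀ b : B₁,
      S.rB '' (lCoset S b (brKer T f) ×ˢ brKer T f) =
        brKer T f ×ˢ lCoset S b (brKer T f) ∧
      S.rB '' (brKer T f ×ˢ lCoset S b (brKer T f)) =
        lCoset S b (brKer T f) ×ˢ brKer T f) := by
  refine ⟨⟨hf.isSolHom, ⟨S.zero, hf.brKer_eq_kerClass_zero⟩, fun z =>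
    ⟨hf.rB_image_brKer_prod_kerClass z, hf.rB_image_kerClass_prod_brKer z⟩⟩,
    hf.kerClass_eq_lCoset, fun b => ?_⟩
  rw [← hf.kerClass_eq_lCoset b]
  exact ⟨hf.rB_image_kerClass_prod_brKer b, hf.rB_image_brKer_prod_kerClass b⟩
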